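/- Fix a cube Q_0 ⊂ ℝ^n, let a : D(Q_0) → [0,∞) be a functional and let f ∈ L^1(Q_0) satisfy (1/|Q|)∫_Q |f − f_Q| dx ≤ a(Q) for every Q ∈ D(Q_0). Let 1 < p < ∞ and suppose a ∈ D_p^{dyadic}(Q_0). Then there is a constant C depending only on p and n such that for every Q ∈ D(Q_0), ‖f − f_Q‖_{L^{p,∞},Q} ≤ C‖a‖_{D_p^{dyadic}(Q_0)} · a(Q). -/

import Mathlib

open MeasureTheory Filter
open scoped ENNReal NNReal Topology

structure Cube (n : ℕ) where
  corner : Fin n → ℝ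
  side : ℝ
  side_pos : 0 < side

namespace Cube

variable {n : ℕ}

/-- The (half-open) cube determined by the data. -/
def set (Q : Cube n) : Set (Fin n → ℝ) :=
  {x | ∀ i, Q.corner i ≤ x i ∧ x i < Q.corner i + Q.side}

/-- The dyadic subcube of `Q` of generation `k` in position `m`. -/
noncomputable def dyadic (Q : Cube n) (k : ℕ) (m : Fin n → ℕ) : Cube n :=
  ⟨fun i => Q.corner i + Q.side / 2 ^ k * (m i : ℝ), Q.side / 2 ^ k,
    div_pos Q.side_pos (by positivity)⟩

/-- `Q` belongs to the family `𝒟(Q₀)` of dyadic subcubes of `Q₀`. -/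
def IsDyadicSub (Q₀ Q : Cube n) : Prop :=
  ∃ (k : ℕ) (m : Fin n → ℕ), (∀ i, m i < 2 ^ k) ∧ Q = Q₀.dyadic k m

/-- The average `(1/|Q|)∫_Q f dx` (of a nonnegative function), with values in `ℝ≥0∞`. -/
noncomputable def avg (Q : Cube n) (f : (Fin n → ℝ) → ℝ) : ℝ≥0∞ :=
  (∫⁻ x in Q.set, ENNReal.ofReal (f x)) / volume Q.set

/-- The (real-valued) average `f_Q = (1/|Q|)∫_Q f dx`. -/
noncomputable def ravg (Q : Cube n) (f : (Fin n → ℝ) → ℝ) : ℝ :=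
  ⨍ x in Q.set, f x

/-- The local dyadic maximal function `M_{Q₀} f`. -/
noncomputable def maximal (Q₀ : Cube n) (f : (Fin n → ℝ) → ℝ) (x : Fin n → ℝ) : ℝ≥0∞ :=
  ⨆ (k : ℕ) (m : Fin n → ℕ) (_ : (∀ i, m i < 2 ^ k) ∧ x ∈ (Q₀.dyadic k m).set),
    avg (Q₀.dyadic k m) f

/-- `G*_{Q₀}(x) = sup { g(Q) : Q ∈ 𝒟(Q₀), x ∈ Q }`. -/
noncomputable def gstar (Q₀ : Cube n) (g : Cube n → ℝ) (x : Fin n → ℝ) : ℝ≥0∞ :=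
  ⨆ (k : ℕ) (m : Fin n → ℕ) (_ : (∀ i, m i < 2 ^ k) ∧ x ∈ (Q₀.dyadic k m).set),
    ENNReal.ofReal (g (Q₀.dyadic k m))

/-- The local dyadic sharp maximal function `M^#_{Q₀} f`. -/
noncomputable def sharpMaximal (Q₀ : Cube n) (f : (Fin n → ℝ) → ℝ) (x : Fin n → ℝ) : ℝ≥0∞ :=
  ⨆ (k : ℕ) (m : Fin n → ℕ) (_ : (∀ i, m i < 2 ^ k) ∧ x ∈ (Q₀.dyadic k m).set),
    avg (Q₀.dyadic k m) (fun y => |f y - ravg (Q₀.dyadic k m) f|)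

/-- The normalized weak `L^p` (quasi-)norm on a cube, for an `ℝ≥0∞`-valued function. -/
noncomputable def wnorm (Q : Cube n) (p : ℝ) (f : (Fin n → ℝ) → ℝ≥0∞) : ℝ≥0∞ :=
  ⨆ (t : ℝ) (_ : 0 < t),
    ENNReal.ofReal t * (volume {x ∈ Q.set | ENNReal.ofReal t < f x} / volume Q.set) ^ (1 / p)

/-- The normalized `L^p` norm `((1/|Q|)∫_Q f^p dx)^{1/p}` for an `ℝ≥0∞`-valued function. -/
noncomputable def lpnorm (Q : Cube n) (p : ℝ) (f : (Fin n → ℝ) → ℝ≥0∞) : ℝ≥0∞ :=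
  ((∫⁻ x in Q.set, f x ^ p) / volume Q.set) ^ (1 / p)

/-- The dyadic John–Nirenberg functional `‖f‖_{JN_p^{dyadic},Q}`. -/
noncomputable def jnNorm (Q : Cube n) (p : ℝ) (f : (Fin n → ℝ) → ℝ) : ℝ≥0∞ :=
  ⨆ (𝒮 : Set (Cube n)) (_ : (∀ R ∈ 𝒮, Q.IsDyadicSub R) ∧ 𝒮.PairwiseDisjoint Cube.set),
    ((∑' R : 𝒮, avg (R : Cube n) (fun x => |f x - ravg (R : Cube n) f|) ^ p *
        volume (R : Cube n).set) / volume Q.set) ^ (1 / p)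

/-- `sup ((1/|Q|) Σ_i a(Q_i)^p |Q_i|)^{1/p}` over pairwise disjoint families in `𝒟(Q)`. -/
noncomputable def dpSup (Q : Cube n) (p : ℝ) (a : Cube n → ℝ) : ℝ≥0∞ :=
  ⨆ (𝒮 : Set (Cube n)) (_ : (∀ R ∈ 𝒮, Q.IsDyadicSub R) ∧ 𝒮.PairwiseDisjoint Cube.set),
    ((∑' R : 𝒮, ENNReal.ofReal (a (R : Cube n)) ^ p * volume (R : Cube n).set) /
      volume Q.set) ^ (1 / p)

/-- `‖a‖_{D_p,Q}`. -/
noncomputable def dpNorm (Q : Cube n) (p : ℝ) (a : Cube n → ℝ) : ℝ≥0∞ :=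
  dpSup Q p a / ENNReal.ofReal (a Q)

/-- `‖a‖_{D_p^{dyadic}(Q₀)}`. -/
noncomputable def dpGlobal (Q₀ : Cube n) (p : ℝ) (a : Cube n → ℝ) : ℝ≥0∞ :=
  ⨆ (Q : Cube n) (_ : Q₀.IsDyadicSub Q), dpNorm Q p a

end Cube

namespace Cube

variable {n : ℕ}

/-- The position of the generation `k` dyadic subcube of `Q` containing `x`. -/
noncomputable def idx (Q : Cube n) (k : ℕ) (x : Fin n → ℝ) (i : Fin n) : ℕ :=
  ⌊(x i - Q.corner i) / (Q.side / 2 ^ k)⌋₊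

/-- The generation `k` dyadic subcube of `Q` containing `x`. -/
noncomputable def cubeAt (Q : Cube n) (k : ℕ) (x : Fin n → ℝ) : Cube n :=
  Q.dyadic k (Q.idx k x)

theorem set_eq_pi (Q : Cube n) :
    Q.set = Set.univ.pi fun i => Set.Ico (Q.corner i) (Q.corner i + Q.side) := by
  ext x; simp [set]

theorem measurableSet_set (Q : Cube n) : MeasurableSet Q.set := by
  rw [set_eq_pi]
  exact MeasurableSet.univ_pi fun _ => measurableSet_Ico

theorem volume_set (Q : Cube n) : volume Q.set = ENNReal.ofReal Q.side ^ n := by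
  rw [set_eq_pi, Real.volume_pi_Ico]
  simp

theorem volume_set_ne_zero (Q : Cube n) : volume Q.set ≠ 0 := by
  rw [volume_set]
  exact pow_ne_zero _ (ENNReal.ofReal_pos.2 Q.side_pos).ne'

theorem volume_set_ne_top (Q : Cube n) : volume Q.set ≠ ⊤ := by
  rw [volume_set]
  exact ENNReal.pow_ne_top ENNReal.ofReal_ne_top

theorem avg_mul_volume (Q : Cube n) (g : (Fin n → ℝ) → ℝ) :
    avg Q g * volume Q.set = ∫⁻ x in Q.set, ENNReal.ofReal (g x) :=
  ENNReal.div_mul_cancel Q.volume_set_ne_zero Q.volume_set_ne_top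

theorem mem_dyadic_iff {Q : Cube n} {k : ℕ} {m : Fin n → ℕ} {x : Fin n → ℝ} :
    x ∈ (Q.dyadic k m).set ↔ (∀ i, Q.corner i ≤ x i) ∧ Q.idx k x = m := by
  have hh : 0 < Q.side / 2 ^ k := div_pos Q.side_pos (by positivity)
  have key (i : Fin n) : ((Q.dyadic k m).corner i ≤ x i ∧
      x i < (Q.dyadic k m).corner i + (Q.dyadic k m).side) ↔
      Q.corner i ≤ x i ∧ Q.idx k x i = m i := by
    simp only [dyadic, idx]
    constructor
    · rintro ⟨h1, h2⟩
      have h0 : 0 ≤ Q.side / 2 ^ k * (m i : ℝ) := by positivity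
      refine ⟨by linarith, (Nat.floor_eq_iff (div_nonneg (by linarith) hh.le)).2 ⟨?_, ?_⟩⟩
      · rw [le_div_iff₀ hh]; linarith
      · rw [div_lt_iff₀ hh]; linarith
    · rintro ⟨h1, h2⟩
      obtain ⟨h3, h4⟩ := (Nat.floor_eq_iff (div_nonneg (by linarith) hh.le)).1 h2
      rw [le_div_iff₀ hh] at h3
      rw [div_lt_iff₀ hh] at h4
      constructor <;> linarith
  exact (forall_congr' key).trans (by rw [forall_and, funext_iff])

theorem dyadic_zero (Q : Cube n) : Q.dyadic 0 0 = Q := by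
  cases Q; simp [dyadic]

theorem isDyadicSub_refl (Q : Cube n) : Q.IsDyadicSub Q :=
  ⟨0, 0, by simp, Q.dyadic_zero.symm⟩

theorem IsDyadicSub.trans {Q R S : Cube n} (h : Q.IsDyadicSub R) (h' : R.IsDyadicSub S) :
    Q.IsDyadicSub S := by
  obtain ⟨k, m, hm, rfl⟩ := h
  obtain ⟨j, l, hl, rfl⟩ := h'
  refine ⟨k + j, fun i => 2 ^ j * m i + l i, fun i => ?_, ?_⟩
  · have h1 : 2 ^ j * (m i + 1) ≤ 2 ^ j * 2 ^ k := Nat.mul_le_mul_left _ (hm i)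
    have h2 := hl i
    rw [pow_add]
    nlinarith
  · simp only [dyadic, Cube.mk.injEq]
    refine ⟨funext fun i => ?_, ?_⟩
    · push_cast
      field_simp
      ring
    · field_simp
      ring

theorem idx_lt {Q : Cube n} {x : Fin n → ℝ} (hx : x ∈ Q.set) (k : ℕ) (i : Fin n) :
    Q.idx k x i < 2 ^ k := by
  have hh : 0 < Q.side / 2 ^ k := div_pos Q.side_pos (by positivity)
  have := hx i
  rw [idx, Nat.floor_lt (div_nonneg (by linarith) hh.le), div_lt_iff₀ hh]
  push_cast
  rw [mul_div_cancel₀ _ (by positivity)]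
  linarith

theorem isDyadicSub_cubeAt {Q : Cube n} {x : Fin n → ℝ} (hx : x ∈ Q.set) (k : ℕ) :
    Q.IsDyadicSub (Q.cubeAt k x) :=
  ⟨k, _, idx_lt hx k, rfl⟩

theorem mem_cubeAt {Q : Cube n} {x : Fin n → ℝ} (hx : x ∈ Q.set) (k : ℕ) :
    x ∈ (Q.cubeAt k x).set :=
  mem_dyadic_iff.2 ⟨fun i => (hx i).1, rfl⟩

theorem cubeAt_zero {Q : Cube n} {x : Fin n → ℝ} (hx : x ∈ Q.set) : Q.cubeAt 0 x = Q := by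
  have : Q.idx 0 x = 0 := funext fun i => by simpa using idx_lt hx 0 i
  rw [cubeAt, this, dyadic_zero]

theorem IsDyadicSub.subset {Q R : Cube n} (h : Q.IsDyadicSub R) : R.set ⊆ Q.set := by
  obtain ⟨k, m, hm, rfl⟩ := h
  intro x hx i
  have h1 := hx i
  have h2 : (m i : ℝ) + 1 ≤ 2 ^ k := by exact_mod_cast hm i
  have hh : 0 < Q.side / 2 ^ k := div_pos Q.side_pos (by positivity)
  have h3 := mul_le_mul_of_nonneg_left h2 hh.le
  rw [div_mul_cancel₀ _ (by positivity)] at h3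
  have h0 : 0 ≤ Q.side / 2 ^ k * (m i : ℝ) := by positivity
  simp only [dyadic] at h1
  constructor <;> linarith

theorem cubeAt_eq_of_mem {Q : Cube n} {k : ℕ} {x y : Fin n → ℝ} (h : y ∈ (Q.cubeAt k x).set) :
    Q.cubeAt k y = Q.cubeAt k x := by
  rw [cubeAt, (mem_dyadic_iff.1 h).2, cubeAt]

theorem idx_eq_div (Q : Cube n) (j d : ℕ) (x : Fin n → ℝ) (i : Fin n) :
    Q.idx j x i = Q.idx (j + d) x i / 2 ^ d := by
  rw [idx, idx, ← Nat.floor_div_natCast]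
  congr 1
  push_cast
  have := Q.side_pos
  field_simp
  ring

theorem cubeAt_eq_of_mem_of_le {Q : Cube n} {j k : ℕ} (hjk : j ≤ k) {x y : Fin n → ℝ}
    (h : y ∈ (Q.cubeAt k x).set) : Q.cubeAt j y = Q.cubeAt j x := by
  obtain ⟨d, rfl⟩ := Nat.exists_eq_add_of_le hjk
  have h' := (mem_dyadic_iff.1 h).2
  have : Q.idx j y = Q.idx j x := funext fun i => by rw [idx_eq_div Q j d, h', ← idx_eq_div]
  rw [cubeAt, this, cubeAt]

theorem volume_cubeAt_succ (Q : Cube n) (k : ℕ) (x : Fin n → ℝ) :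
    volume (Q.cubeAt k x).set = 2 ^ n * volume (Q.cubeAt (k + 1) x).set := by
  rw [volume_set, volume_set, ← mul_pow]
  congr 1
  have : (2 : ℝ≥0∞) = ENNReal.ofReal 2 := by simp
  rw [this, ← ENNReal.ofReal_mul (by norm_num)]
  congr 1
  simp only [cubeAt, dyadic]
  field_simp
  ring

theorem cubeAt_subset_of_le {Q : Cube n} {j k : ℕ} (hjk : j ≤ k) {x : Fin n → ℝ}
    (hx : x ∈ Q.set) : (Q.cubeAt k x).set ⊆ (Q.cubeAt j x).set := fun y hy => by
  rw [← cubeAt_eq_of_mem_of_le hjk hy]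
  exact mem_cubeAt ((isDyadicSub_cubeAt hx k).subset hy) j

theorem countable_isDyadicSub (Q : Cube n) : {R | Q.IsDyadicSub R}.Countable := by
  refine (Set.countable_range fun q : ℕ × (Fin n → ℕ) => Q.dyadic q.1 q.2).mono ?_
  rintro R ⟨k, m, -, rfl⟩
  exact ⟨(k, m), rfl⟩

end Cube

namespace Cube

variable {n : ℕ}

/-- The set where the local dyadic maximal function of `g` on `Q` exceeds `t`. -/
def level (Q : Cube n) (g : (Fin n → ℝ) → ℝ) (t : ℝ≥0∞) : Set (Fin n → ℝ) :=
  {x | x ∈ Q.set ∧ ∃ k, t < avg (Q.cubeAt k x) g}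

/-- The Calderón–Zygmund cubes: the maximal dyadic subcubes of `Q` on which the average of `g`
exceeds `t`. -/
def stoppingCubes (Q : Cube n) (g : (Fin n → ℝ) → ℝ) (t : ℝ≥0∞) : Set (Cube n) :=
  {R | ∃ x ∈ Q.set, ∃ k, R = Q.cubeAt k x ∧ t < avg R g ∧ ∀ j < k, avg (Q.cubeAt j x) g ≤ t}

section

variable {Q R S : Cube n} {g : (Fin n → ℝ) → ℝ} {t u : ℝ≥0∞} {z : Fin n → ℝ}

theorem isDyadicSub_of_mem_stoppingCubes (h : R ∈ Q.stoppingCubes g t) : Q.IsDyadicSub R := by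
  obtain ⟨x, hx, k, rfl, -⟩ := h
  exact isDyadicSub_cubeAt hx k

theorem eq_cubeAt_of_mem_stoppingCubes (h : R ∈ Q.stoppingCubes g t) (hz : z ∈ R.set) :
    ∃ k, R = Q.cubeAt k z ∧ t < avg R g ∧ ∀ j < k, avg (Q.cubeAt j z) g ≤ t := by
  obtain ⟨x, hx, k, rfl, h1, h2⟩ := h
  refine ⟨k, (cubeAt_eq_of_mem hz).symm, h1, fun j hj => ?_⟩
  rw [cubeAt_eq_of_mem_of_le hj.le hz]
  exact h2 j hj

theorem pairwiseDisjoint_stoppingCubes : (Q.stoppingCubes g t).PairwiseDisjoint Cube.set := by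
  intro R hR S hS hne
  refine Set.disjoint_left.2 fun z hzR hzS => hne ?_
  obtain ⟨k, rfl, h1, h2⟩ := eq_cubeAt_of_mem_stoppingCubes hR hzR
  obtain ⟨j, rfl, h3, h4⟩ := eq_cubeAt_of_mem_stoppingCubes hS hzS
  rcases lt_trichotomy k j with h | rfl | h
  · exact absurd h1 (h4 k h).not_gt
  · rfl
  · exact absurd h3 (h2 j h).not_gt

theorem subset_of_mem_stoppingCubes (htu : t ≤ u) (hR : R ∈ Q.stoppingCubes g t)
    (hS : S ∈ Q.stoppingCubes g u)
    (hzR : z ∈ R.set) (hzS : z ∈ S.set) : S.set ⊆ R.set := by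
  have hz : z ∈ Q.set := (isDyadicSub_of_mem_stoppingCubes hR).subset hzR
  obtain ⟨k, rfl, h1, h2⟩ := eq_cubeAt_of_mem_stoppingCubes hR hzR
  obtain ⟨j, rfl, h3, h4⟩ := eq_cubeAt_of_mem_stoppingCubes hS hzS
  rcases le_or_gt k j with h | h
  · exact cubeAt_subset_of_le h hz
  · exact absurd h3 ((h2 j h).trans htu).not_gt

theorem level_eq_biUnion : Q.level g t = ⋃ R ∈ Q.stoppingCubes g t, R.set := by
  classical
  ext x
  simp only [Set.mem_iUnion, exists_prop]
  constructor
  · rintro ⟨hx, h⟩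
    exact ⟨_, ⟨x, hx, Nat.find h, rfl, Nat.find_spec h,
      fun j hj => not_lt.1 (Nat.find_min h hj)⟩, mem_cubeAt hx _⟩
  · rintro ⟨R, hR, hx⟩
    refine ⟨(isDyadicSub_of_mem_stoppingCubes hR).subset hx, ?_⟩
    obtain ⟨k, rfl, h1, -⟩ := eq_cubeAt_of_mem_stoppingCubes hR hx
    exact ⟨k, h1⟩

theorem countable_stoppingCubes : (Q.stoppingCubes g t).Countable :=
  Q.countable_isDyadicSub.mono fun _ => isDyadicSub_of_mem_stoppingCubes

theorem volume_level :
    volume (Q.level g t) = ∑' R : Q.stoppingCubes g t, volume (R : Cube n).set := by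
  rw [level_eq_biUnion]
  exact measure_biUnion countable_stoppingCubes pairwiseDisjoint_stoppingCubes
    fun R _ => R.measurableSet_set

theorem level_subset : Q.level g t ⊆ Q.set := fun _ h => h.1

theorem level_anti (htu : t ≤ u) : Q.level g u ⊆ Q.level g t :=
  fun _ ⟨hx, k, h⟩ => ⟨hx, k, htu.trans_lt h⟩

theorem avg_le_of_mem_stoppingCubes (ht : avg Q g ≤ t) (hR : R ∈ Q.stoppingCubes g t) :
    avg R g ≤ 2 ^ n * t := by
  obtain ⟨x, hx, k, rfl, h1, h2⟩ := hR
  rcases k with _ | k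
  · rw [cubeAt_zero hx] at h1
    exact absurd h1 ht.not_gt
  · refine ENNReal.div_le_of_le_mul ?_
    have h3 := h2 k k.lt_succ_self
    calc ∫⁻ x in (Q.cubeAt (k + 1) x).set, ENNReal.ofReal (g x)
        ≤ ∫⁻ x in (Q.cubeAt k x).set, ENNReal.ofReal (g x) :=
          lintegral_mono_set (cubeAt_subset_of_le k.le_succ hx)
      _ = avg (Q.cubeAt k x) g * volume (Q.cubeAt k x).set := (avg_mul_volume _ _).symm
      _ ≤ t * volume (Q.cubeAt k x).set := by gcongr
      _ = 2 ^ n * t * volume (Q.cubeAt (k + 1) x).set := by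
          rw [volume_cubeAt_succ]; ring

end

section

variable {Q R : Cube n} {f : (Fin n → ℝ) → ℝ} {t : ℝ≥0∞}

theorem ofReal_abs_ravg_sub_le (hf : IntegrableOn f R.set) (c : ℝ) :
    ENNReal.ofReal |ravg R f - c| ≤ avg R fun x => |f x - c| := by
  have : IsFiniteMeasure (volume.restrict R.set) :=
    ⟨by simpa using R.volume_set_ne_top.lt_top⟩
  have hi : IntegrableOn (fun x => f x - c) R.set := hf.sub (integrable_const c)
  have h0 : volume.real R.set ≠ 0 :=
    ENNReal.toReal_ne_zero.2 ⟨R.volume_set_ne_zero, R.volume_set_ne_top⟩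
  have h1 : ravg R f - c = ⨍ x in R.set, (f x - c) := by
    rw [ravg, setAverage_eq, setAverage_eq, integral_sub hf (integrable_const c)]
    simp only [integral_const, smul_eq_mul, measureReal_restrict_apply_univ, mul_sub]
    rw [inv_mul_cancel_left₀ h0]
  rw [avg, ← ofReal_setAverage hi.abs (ae_of_all _ fun x => abs_nonneg _), h1]
  refine ENNReal.ofReal_le_ofReal ?_
  rw [setAverage_eq, setAverage_eq, smul_eq_mul, smul_eq_mul, abs_mul,
    abs_of_nonneg (inv_nonneg.2 measureReal_nonneg)]
  gcongr
  exact abs_integral_le_integral_abs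

theorem mul_volume_level_inter_le (hf : IntegrableOn f Q.set)
    (ht : avg Q (fun x => |f x - ravg Q f|) ≤ t) (htop : t ≠ ⊤)
    (hR : R ∈ Q.stoppingCubes (fun x => |f x - ravg Q f|) t) :
    t * volume (Q.level (fun x => |f x - ravg Q f|) ((2 ^ n + 1) * t) ∩ R.set) ≤
      avg R (fun x => |f x - ravg R f|) * volume R.set := by
  set g := fun x => |f x - ravg Q f| with hg
  set u := (2 ^ n + 1) * t with hu
  have htu : t ≤ u := le_mul_of_one_le_left' (by simp)
  set 𝒯 : Set (Cube n) := {S | S ∈ Q.stoppingCubes g u ∧ S.set ⊆ R.set}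
  have h𝒯 : 𝒯 ⊆ Q.stoppingCubes g u := fun S hS => hS.1
  have hc : 𝒯.Countable := countable_stoppingCubes.mono h𝒯
  have hsub : Q.level g u ∩ R.set ⊆ ⋃ S ∈ 𝒯, S.set := by
    rintro x ⟨hx, hxR⟩
    rw [level_eq_biUnion] at hx
    simp only [Set.mem_iUnion, exists_prop] at hx ⊢
    obtain ⟨S, hS, hxS⟩ := hx
    exact ⟨S, ⟨hS, subset_of_mem_stoppingCubes htu hR hS hxR hxS⟩, hxS⟩
  have hQR : ENNReal.ofReal |ravg R f - ravg Q f| ≤ 2 ^ n * t :=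
    (ofReal_abs_ravg_sub_le (hf.mono_set (isDyadicSub_of_mem_stoppingCubes hR).subset) _).trans
      (avg_le_of_mem_stoppingCubes ht hR)
  have key (S : Cube n) (hS : S ∈ 𝒯) :
      t * volume S.set ≤ ∫⁻ x in S.set, ENNReal.ofReal |f x - ravg R f| := by
    obtain ⟨-, -, -, -, h1, -⟩ := hS.1
    have h2 : u * volume S.set ≤ ∫⁻ x in S.set, ENNReal.ofReal (g x) := by
      rw [← avg_mul_volume]
      gcongr
    have h3 : ∫⁻ x in S.set, ENNReal.ofReal (g x) ≤
        (∫⁻ x in S.set, ENNReal.ofReal |f x - ravg R f|) + 2 ^ n * t * volume S.set := by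
      rw [← setLIntegral_const, ← lintegral_add_right _ measurable_const]
      refine lintegral_mono fun x => ?_
      refine le_trans ?_ (add_le_add_right hQR _)
      rw [← ENNReal.ofReal_add (abs_nonneg _) (abs_nonneg _)]
      exact ENNReal.ofReal_le_ofReal (abs_sub_le _ _ _)
    have h4 : u * volume S.set = t * volume S.set + 2 ^ n * t * volume S.set := by
      rw [hu]; ring
    have h5 := h2.trans h3
    rw [h4] at h5
    exact (ENNReal.add_le_add_iff_right
      (ENNReal.mul_ne_top (ENNReal.mul_ne_top (by simp) htop) S.volume_set_ne_top)).1 h5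
  calc t * volume (Q.level g u ∩ R.set)
      ≤ t * ∑' S : 𝒯, volume (S : Cube n).set := by
        gcongr
        exact (measure_mono hsub).trans (measure_biUnion_le _ hc _)
    _ = ∑' S : 𝒯, t * volume (S : Cube n).set := ENNReal.tsum_mul_left.symm
    _ ≤ ∑' S : 𝒯, ∫⁻ x in (S : Cube n).set, ENNReal.ofReal |f x - ravg R f| :=
        ENNReal.tsum_le_tsum fun S => key S S.2
    _ = ∫⁻ x in ⋃ S ∈ 𝒯, S.set, ENNReal.ofReal |f x - ravg R f| :=
        (lintegral_biUnion hc (fun S _ => S.measurableSet_set)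
          (pairwiseDisjoint_stoppingCubes.subset h𝒯) _).symm
    _ ≤ ∫⁻ x in R.set, ENNReal.ofReal |f x - ravg R f| :=
        lintegral_mono_set (Set.iUnion₂_subset fun S hS => hS.2)
    _ = _ := (avg_mul_volume _ _).symm

/-- The good-`λ` inequality. -/
theorem mul_volume_level_le (hf : IntegrableOn f Q.set)
    (ht : avg Q (fun x => |f x - ravg Q f|) ≤ t) (htop : t ≠ ⊤) :
    t * volume (Q.level (fun x => |f x - ravg Q f|) ((2 ^ n + 1) * t)) ≤
      ∑' R : Q.stoppingCubes (fun x => |f x - ravg Q f|) t,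
        avg (R : Cube n) (fun x => |f x - ravg R f|) * volume (R : Cube n).set := by
  set g := fun x => |f x - ravg Q f| with hg
  set u := (2 ^ n + 1) * t with hu
  have hsub : Q.level g u ⊆ ⋃ R ∈ Q.stoppingCubes g t, Q.level g u ∩ R.set := by
    rw [← Set.inter_iUnion₂, ← level_eq_biUnion]
    exact Set.subset_inter subset_rfl (level_anti (le_mul_of_one_le_left' (by simp)))
  calc t * volume (Q.level g u)
      ≤ t * ∑' R : Q.stoppingCubes g t, volume (Q.level g u ∩ (R : Cube n).set) := by
        gcongr
        exact (measure_mono hsub).trans (measure_biUnion_le _ countable_stoppingCubes _)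
    _ = ∑' R : Q.stoppingCubes g t, t * volume (Q.level g u ∩ (R : Cube n).set) :=
        ENNReal.tsum_mul_left.symm
    _ ≤ _ := ENNReal.tsum_le_tsum fun R => mul_volume_level_inter_le hf ht htop R.2

/-- Lebesgue differentiation along dyadic cubes. -/
theorem ae_mem_level {g : (Fin n → ℝ) → ℝ} (hg : IntegrableOn g Q.set) (hg0 : ∀ x, 0 ≤ g x) :
    ∀ᵐ x, x ∈ Q.set → ∀ t : ℝ≥0∞, t < ENNReal.ofReal (g x) → x ∈ Q.level g t := by
  have hG : Integrable (Q.set.indicator g) := hg.integrable_indicator Q.measurableSet_set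
  filter_upwards [IsUnifLocDoublingMeasure.ae_tendsto_average (μ := volume)
    hG.locallyIntegrable 1] with x hx hxQ t ht
  by_contra hcon
  have hle (k : ℕ) : avg (Q.cubeAt k x) g ≤ t := not_lt.1 fun h => hcon ⟨hxQ, k, h⟩
  let δ : ℕ → ℝ := fun k => Q.side / 2 ^ k / 2
  let w : ℕ → Fin n → ℝ := fun k i => (Q.cubeAt k x).corner i + δ k
  have hδ (k : ℕ) : 0 < δ k := by have := Q.side_pos; positivity
  have hball (k : ℕ) : Metric.closedBall (w k) (δ k) = Set.univ.pi fun i =>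
      Set.Icc ((Q.cubeAt k x).corner i) ((Q.cubeAt k x).corner i + (Q.cubeAt k x).side) := by
    rw [closedBall_pi _ (hδ k).le]
    congr 1
    funext i
    rw [Real.closedBall_eq_Icc]
    simp only [w, δ, cubeAt, dyadic]
    congr 1 <;> ring
  have hae (k : ℕ) : Metric.closedBall (w k) (δ k) =ᵐ[volume] (Q.cubeAt k x).set := by
    rw [hball, set_eq_pi, Set.pi_univ_Icc]
    exact Measure.univ_pi_Ico_ae_eq_Icc.symm
  have hlim : Tendsto δ atTop (𝓝[>] 0) := by
    refine tendsto_nhdsWithin_iff.2 ⟨?_, Eventually.of_forall hδ⟩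
    have h := (tendsto_pow_atTop_nhds_zero_of_lt_one (r := (1 / 2 : ℝ)) (by norm_num)
      (by norm_num)).const_mul (Q.side / 2)
    rw [mul_zero] at h
    refine h.congr fun k => ?_
    simp only [δ, one_div, inv_pow]
    ring
  have hmem (k : ℕ) : x ∈ Metric.closedBall (w k) (1 * δ k) := by
    rw [one_mul, hball]
    exact fun i _ => ⟨(mem_cubeAt hxQ k i).1, (mem_cubeAt hxQ k i).2.le⟩
  have h1 := hx w δ hlim (Eventually.of_forall hmem)
  rw [Set.indicator_of_mem hxQ] at h1
  have h2 := (ENNReal.continuous_ofReal.tendsto _).comp h1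
  refine ht.not_ge (le_of_tendsto' h2 fun k => ?_)
  have hs := (isDyadicSub_cubeAt hxQ k).subset
  have h3 : ⨍ y in Metric.closedBall (w k) (δ k), Q.set.indicator g y =
      ⨍ y in (Q.cubeAt k x).set, g y := by
    rw [setAverage_congr (hae k)]
    exact setAverage_congr_fun (Q.cubeAt k x).measurableSet_set
      (ae_of_all _ fun y hy => Set.indicator_of_mem (hs hy) g)
  rw [Function.comp_apply, h3, ofReal_setAverage (hg.mono_set hs) (ae_of_all _ hg0)]
  exact hle k

end

end Cube

/-- Iteration of a good-`λ` inequality yields power decay. -/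
theorem exists_rpow_mul_le_of_goodLambda {L p : ℝ} (hL : 1 < L) (hp : 1 < p) :
    ∃ B : ℝ, 0 < B ∧ ∀ (m : ℝ → ℝ) (α D V : ℝ), 0 < α → 0 ≤ D → (∀ t, m t ≤ V) →
      α ^ p * V ≤ D → (∀ t, α ≤ t → ∀ s, 0 < s → t * m (L * t) ≤ s * m t + s ^ (1 - p) * D) →
      ∀ t, 0 < t → t ^ p * m t ≤ B * D := by
  have hL0 : 0 < L := by linarith
  have hLp : 1 < L ^ p := Real.one_lt_rpow hL (by linarith)
  set ε : ℝ := (L ^ p)⁻¹ / 2 with hε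
  have hε0 : 0 < ε := by positivity
  have hε1 : ε ≤ 1 := by
    have := inv_le_one_of_one_le₀ hLp.le
    linarith
  have hLε : L ^ p * ε = 1 / 2 := by rw [hε]; field_simp
  set B : ℝ := 2 * L ^ p * ε ^ (1 - p) with hB
  have hBL : L ^ p ≤ B := by
    have h1 : 1 ≤ ε ^ (1 - p) := Real.one_le_rpow_of_pos_of_le_one_of_nonpos hε0 hε1 (by linarith)
    nlinarith
  refine ⟨B, by positivity, fun m α D V hα hD hV hαV hgood => ?_⟩
  have hstart (t : ℝ) (ht : 0 < t) (htα : t ≤ L * α) : t ^ p * m t ≤ B * D := by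
    have hαp : 0 < α ^ p := by positivity
    rcases le_or_gt (m t) 0 with h | h
    · exact (mul_nonpos_of_nonneg_of_nonpos (by positivity) h).trans (by positivity)
    have hV0 : 0 ≤ V := h.le.trans (hV t)
    calc t ^ p * m t ≤ (L * α) ^ p * m t := by gcongr
      _ = L ^ p * (α ^ p * m t) := by rw [Real.mul_rpow hL0.le hα.le]; ring
      _ ≤ L ^ p * (α ^ p * V) := by gcongr; exact hV t
      _ ≤ B * D := by gcongr
  have hind (k : ℕ) : ∀ t, 0 < t → t ≤ L ^ k * α → t ^ p * m t ≤ B * D := by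
    induction k with
    | zero =>
      intro t ht htα
      exact hstart t ht (htα.trans (by simpa using le_mul_of_one_le_left hα.le hL.le))
    | succ k ih =>
      intro t ht htα
      rcases le_or_gt t (L * α) with h | h
      · exact hstart t ht h
      obtain ⟨v, rfl⟩ : ∃ v, t = L * v := ⟨t / L, by field_simp⟩
      have hαv : α < v := lt_of_mul_lt_mul_left h hL0.le
      have hv : 0 < v := hα.trans hαv
      have hvk : v ≤ L ^ k * α := by
        refine le_of_mul_le_mul_left ?_ hL0
        rw [pow_succ] at htα
        linarith
      have h1 := ih v hv hvk
      have h2 := hgood v hαv.le (ε * v) (by positivity)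
      have hvp : v ^ p = v ^ (p - 1) * v := by
        rw [Real.rpow_sub_one hv.ne']; field_simp
      have hvv : v ^ (p - 1) * v ^ (1 - p) = 1 := by
        rw [← Real.rpow_add hv]; simp
      calc (L * v) ^ p * m (L * v) = L ^ p * v ^ (p - 1) * (v * m (L * v)) := by
            rw [Real.mul_rpow hL0.le hv.le, hvp]; ring
        _ ≤ L ^ p * v ^ (p - 1) * (ε * v * m v + (ε * v) ^ (1 - p) * D) := by gcongr
        _ = L ^ p * ε * (v ^ p * m v) +
              L ^ p * ε ^ (1 - p) * D * (v ^ (p - 1) * v ^ (1 - p)) := by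
            rw [Real.mul_rpow hε0.le hv.le, hvp]; ring
        _ ≤ 1 / 2 * (B * D) + B / 2 * D := by
            rw [hLε, hvv, hB]
            linarith
        _ = B * D := by ring
  intro t ht
  obtain ⟨k, hk⟩ := pow_unbounded_of_one_lt (t / α) hL
  exact hind k t ht ((div_le_iff₀ hα).1 hk.le)

theorem le_add_rpow_mul {x s p : ℝ} (hx : 0 ≤ x) (hs : 0 < s) (hp : 1 < p) :
    x ≤ s + s ^ (1 - p) * x ^ p := by
  rcases le_or_gt x s with h | h
  · have : 0 ≤ s ^ (1 - p) * x ^ p := by positivity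
    linarith
  · have hx0 : 0 < x := hs.trans h
    have h1 : x ^ (1 - p) ≤ s ^ (1 - p) :=
      Real.rpow_le_rpow_of_nonpos hs h.le (by linarith)
    have h2 : x ^ (1 - p) * x ^ p = x := by rw [← Real.rpow_add hx0]; simp
    have h3 := mul_le_mul_of_nonneg_right h1 (Real.rpow_nonneg hx p)
    linarith

namespace Cube

variable {n : ℕ} {Q : Cube n} {p : ℝ} {a : Cube n → ℝ} {f : (Fin n → ℝ) → ℝ}

theorem tsum_le_of_dpSup_le {K : ℝ≥0∞} (hp : 0 < p) (h : dpSup Q p a ≤ K) {𝒮 : Set (Cube n)}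
    (h𝒮 : ∀ R ∈ 𝒮, Q.IsDyadicSub R) (hd : 𝒮.PairwiseDisjoint Cube.set) :
    ∑' R : 𝒮, ENNReal.ofReal (a (R : Cube n)) ^ p * volume (R : Cube n).set ≤
      K ^ p * volume Q.set := by
  have h1 := (le_iSup₂ (f := fun (𝒮 : Set (Cube n))
    (_ : (∀ R ∈ 𝒮, Q.IsDyadicSub R) ∧ 𝒮.PairwiseDisjoint Cube.set) =>
    ((∑' R : 𝒮, ENNReal.ofReal (a (R : Cube n)) ^ p * volume (R : Cube n).set) /
      volume Q.set) ^ (1 / p)) 𝒮 ⟨h𝒮, hd⟩).trans h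
  rw [one_div, ENNReal.rpow_inv_le_iff hp] at h1
  exact (ENNReal.div_le_iff Q.volume_set_ne_zero Q.volume_set_ne_top).1 h1

theorem ofReal_rpow_le_of_dpSup_le {K : ℝ≥0∞} (hp : 0 < p) (h : dpSup Q p a ≤ K) :
    ENNReal.ofReal (a Q) ^ p * volume Q.set ≤ K ^ p * volume Q.set := by
  have := tsum_le_of_dpSup_le hp h (𝒮 := {Q}) (by simpa using Q.isDyadicSub_refl)
    (Set.pairwiseDisjoint_singleton _ _)
  rwa [tsum_singleton (f := fun R : Cube n => ENNReal.ofReal (a R) ^ p * volume R.set)] at this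

theorem wnorm_eq_zero (hf : Measurable f) (hp : 0 < p)
    (h : avg Q (fun x => |f x - ravg Q f|) = 0) :
    wnorm Q p (fun x => ENNReal.ofReal |f x - ravg Q f|) = 0 := by
  have h1 := avg_mul_volume Q fun x => |f x - ravg Q f|
  rw [h, zero_mul, eq_comm, lintegral_eq_zero_iff (by fun_prop)] at h1
  rw [EventuallyEq, ae_restrict_iff' Q.measurableSet_set] at h1
  simp only [wnorm, ENNReal.iSup_eq_zero]
  intro t ht
  have h2 : volume {x | x ∈ Q.set ∧ ENNReal.ofReal t < ENNReal.ofReal |f x - ravg Q f|} = 0 := by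
    refine measure_mono_null ?_ h1
    rintro x ⟨hx, hlt⟩ hx0
    exact not_lt_zero ((hx0 hx) ▸ hlt)
  rw [h2, ENNReal.zero_div, ENNReal.zero_rpow_of_pos (by positivity), mul_zero]

theorem wnorm_le {C K : ℝ} (hp : 0 < p) (hC : 0 ≤ C) (hK : 0 ≤ K)
    (hf : IntegrableOn (fun x => |f x - ravg Q f|) Q.set)
    (h : ∀ t : ℝ, 0 < t →
      t ^ p * volume.real (Q.level (fun x => |f x - ravg Q f|) (ENNReal.ofReal t)) ≤
        C * (K ^ p * volume.real Q.set)) :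
    wnorm Q p (fun x => ENNReal.ofReal |f x - ravg Q f|) ≤
      ENNReal.ofReal (C ^ (1 / p)) * ENNReal.ofReal K := by
  set g := fun x => |f x - ravg Q f| with hg
  refine iSup₂_le fun t ht => ?_
  have hV : 0 < volume.real Q.set :=
    ENNReal.toReal_pos Q.volume_set_ne_zero Q.volume_set_ne_top
  have hfin : volume (Q.level g (ENNReal.ofReal t)) ≠ ⊤ :=
    ne_top_of_le_ne_top Q.volume_set_ne_top (measure_mono level_subset)
  have h1 : volume {x | x ∈ Q.set ∧ ENNReal.ofReal t < ENNReal.ofReal (g x)} ≤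
      volume (Q.level g (ENNReal.ofReal t)) := by
    refine measure_mono_ae ?_
    filter_upwards [ae_mem_level hf fun x => abs_nonneg _] with x hx
    exact fun hx' => hx hx'.1 _ hx'.2
  have h2 : volume (Q.level g (ENNReal.ofReal t)) / volume Q.set ≤
      ENNReal.ofReal (C * K ^ p / t ^ p) := by
    rw [ENNReal.div_le_iff Q.volume_set_ne_zero Q.volume_set_ne_top,
      ← ENNReal.ofReal_toReal Q.volume_set_ne_top, ← ENNReal.ofReal_mul (by positivity),
      ← ENNReal.ofReal_toReal hfin]
    refine ENNReal.ofReal_le_ofReal ?_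
    have htp : 0 < t ^ p := by positivity
    rw [div_mul_eq_mul_div, le_div_iff₀ htp]
    have := h t ht
    simp only [Measure.real] at this
    linarith
  calc ENNReal.ofReal t *
        (volume {x | x ∈ Q.set ∧ ENNReal.ofReal t < ENNReal.ofReal (g x)} / volume Q.set) ^ (1 / p)
      ≤ ENNReal.ofReal t * ENNReal.ofReal (C * K ^ p / t ^ p) ^ (1 / p) := by
        gcongr
        exact (ENNReal.div_le_div_right h1 _).trans h2
    _ = ENNReal.ofReal (C ^ (1 / p)) * ENNReal.ofReal K := by
        rw [ENNReal.ofReal_rpow_of_nonneg (by positivity) (by positivity),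
          ← ENNReal.ofReal_mul ht.le, ← ENNReal.ofReal_mul (by positivity)]
        congr 1
        rw [Real.div_rpow (by positivity) (by positivity), Real.mul_rpow hC (by positivity),
          one_div, Real.rpow_rpow_inv hK hp.ne', Real.rpow_rpow_inv ht.le hp.ne']
        field_simp

/-- The good-`λ` inequality in terms of the functional `a`, with the constant `K` bounding the
`D_p` supremum. -/
theorem mul_volume_level_le_of_dpSup_le {K : ℝ≥0∞} (hp : 1 < p) (hKtop : K ≠ ⊤)
    (ha : ∀ R, 0 ≤ a R) (hf : IntegrableOn f Q.set)
    (hosc : ∀ R, Q.IsDyadicSub R → avg R (fun x => |f x - ravg R f|) ≤ ENNReal.ofReal (a R))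
    (hK : dpSup Q p a ≤ K) {t s : ℝ} (ht : a Q ≤ t) (hs : 0 < s) :
    t * volume.real (Q.level (fun x => |f x - ravg Q f|) (ENNReal.ofReal ((2 ^ n + 1) * t))) ≤
      s * volume.real (Q.level (fun x => |f x - ravg Q f|) (ENNReal.ofReal t)) +
        s ^ (1 - p) * (K.toReal ^ p * volume.real Q.set) := by
  set g := fun x => |f x - ravg Q f| with hg
  have ht0 : 0 ≤ t := (ha Q).trans ht
  have hlam : ENNReal.ofReal ((2 ^ n + 1) * t) = (2 ^ n + 1) * ENNReal.ofReal t := by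
    rw [ENNReal.ofReal_mul (by positivity), ENNReal.ofReal_add (by positivity) (by positivity),
      ENNReal.ofReal_pow (by norm_num)]
    simp
  have hyoung (R : Cube n) : ENNReal.ofReal (a R) ≤
      ENNReal.ofReal s + ENNReal.ofReal (s ^ (1 - p)) * ENNReal.ofReal (a R) ^ p := by
    rw [ENNReal.ofReal_rpow_of_nonneg (ha R) (by linarith), ← ENNReal.ofReal_mul (by positivity),
      ← ENNReal.ofReal_add hs.le (mul_nonneg (by positivity) (Real.rpow_nonneg (ha R) _))]
    exact ENNReal.ofReal_le_ofReal (le_add_rpow_mul (ha R) hs hp)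
  have main : ENNReal.ofReal t * volume (Q.level g (ENNReal.ofReal ((2 ^ n + 1) * t))) ≤
      ENNReal.ofReal s * volume (Q.level g (ENNReal.ofReal t)) +
        ENNReal.ofReal (s ^ (1 - p)) * (K ^ p * volume Q.set) := by
    calc _ ≤ ∑' R : Q.stoppingCubes g (ENNReal.ofReal t),
          avg (R : Cube n) (fun x => |f x - ravg R f|) * volume (R : Cube n).set := by
          rw [hlam]
          exact mul_volume_level_le hf
            ((hosc Q Q.isDyadicSub_refl).trans (ENNReal.ofReal_le_ofReal ht))
            ENNReal.ofReal_ne_top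
      _ ≤ ∑' R : Q.stoppingCubes g (ENNReal.ofReal t), (ENNReal.ofReal s * volume (R : Cube n).set +
            ENNReal.ofReal (s ^ (1 - p)) *
              (ENNReal.ofReal (a R) ^ p * volume (R : Cube n).set)) := by
          refine ENNReal.tsum_le_tsum fun R => ?_
          rw [← mul_assoc, ← add_mul]
          gcongr
          exact (hosc R (isDyadicSub_of_mem_stoppingCubes R.2)).trans (hyoung R)
      _ ≤ _ := by
          rw [ENNReal.tsum_add, ENNReal.tsum_mul_left, ENNReal.tsum_mul_left, ← volume_level]
          gcongr
          exact tsum_le_of_dpSup_le (by linarith) hK (fun R => isDyadicSub_of_mem_stoppingCubes)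
            pairwiseDisjoint_stoppingCubes
  have hfin (u : ℝ≥0∞) : volume (Q.level g u) ≠ ⊤ :=
    ne_top_of_le_ne_top Q.volume_set_ne_top (measure_mono level_subset)
  have hD : K ^ p * volume Q.set ≠ ⊤ :=
    ENNReal.mul_ne_top (ENNReal.rpow_ne_top_of_nonneg (by linarith) hKtop) Q.volume_set_ne_top
  have h1 := ENNReal.mul_ne_top (ENNReal.ofReal_ne_top (r := s)) (hfin (ENNReal.ofReal t))
  have h2 := ENNReal.mul_ne_top (ENNReal.ofReal_ne_top (r := s ^ (1 - p))) hD
  have := ENNReal.toReal_mono (ENNReal.add_ne_top.2 ⟨h1, h2⟩) main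
  rw [ENNReal.toReal_add h1 h2] at this
  simpa only [Measure.real, ENNReal.toReal_mul, ENNReal.toReal_ofReal ht0,
    ENNReal.toReal_ofReal hs.le, ENNReal.toReal_ofReal (Real.rpow_nonneg hs.le (1 - p)),
    ← ENNReal.toReal_rpow] using this

end Cube

/-- **Franchi–Pérez–Wheeden self-improvement (dyadic case).** -/
theorem FPW_selfimprovement_dyadic (n : ℕ) (p : ℝ) (hp : 1 < p) :
    ∃ C : ℝ, 0 < C ∧
      ∀ (Q₀ : Cube n) (a : Cube n → ℝ) (f : (Fin n → ℝ) → ℝ),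
        Measurable f → IntegrableOn f Q₀.set → (∀ Q, 0 ≤ a Q) →
        (∀ Q, Q₀.IsDyadicSub Q →
          Cube.avg Q (fun x => |f x - Cube.ravg Q f|) ≤ ENNReal.ofReal (a Q)) →
        Cube.dpGlobal Q₀ p a ≠ ⊤ →
        ∀ Q, Q₀.IsDyadicSub Q →
          Cube.wnorm Q p (fun x => ENNReal.ofReal |f x - Cube.ravg Q f|)
            ≤ ENNReal.ofReal C * Cube.dpGlobal Q₀ p a * ENNReal.ofReal (a Q) := by
  obtain ⟨B, hB, hdecay⟩ := exists_rpow_mul_le_of_goodLambda (L := 2 ^ n + 1)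
    (lt_add_of_pos_left 1 (by positivity)) hp
  refine ⟨B ^ (1 / p), by positivity, fun Q₀ a f hfm hf₀ ha hosc₀ htop Q hQ => ?_⟩
  have hp0 : 0 < p := by linarith
  have hf : IntegrableOn f Q.set := hf₀.mono_set hQ.subset
  have hosc (R : Cube n) (hR : Q.IsDyadicSub R) := hosc₀ R (hQ.trans hR)
  rcases (ha Q).eq_or_lt with h0 | haQ
  · rw [Cube.wnorm_eq_zero hfm hp0]
    · exact zero_le
    · simpa [← h0] using hosc Q Q.isDyadicSub_refl
  set K : ℝ≥0∞ := Cube.dpGlobal Q₀ p a * ENNReal.ofReal (a Q) with hKdef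
  have hKtop : K ≠ ⊤ := ENNReal.mul_ne_top htop ENNReal.ofReal_ne_top
  have hK : Cube.dpSup Q p a ≤ K :=
    (ENNReal.div_le_iff (ENNReal.ofReal_pos.2 haQ).ne' ENNReal.ofReal_ne_top).1
      (le_iSup₂ (f := fun (Q : Cube n) (_ : Q₀.IsDyadicSub Q) => Cube.dpNorm Q p a) Q hQ)
  have hstart : a Q ^ p * volume.real Q.set ≤ K.toReal ^ p * volume.real Q.set := by
    have := ENNReal.toReal_mono
      (ENNReal.mul_ne_top (ENNReal.rpow_ne_top_of_nonneg hp0.le hKtop) Q.volume_set_ne_top)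
      (Cube.ofReal_rpow_le_of_dpSup_le hp0 hK)
    simpa only [Measure.real, ENNReal.toReal_mul, ← ENNReal.toReal_rpow,
      ENNReal.toReal_ofReal haQ.le] using this
  have hosc_int : IntegrableOn (fun x => |f x - Cube.ravg Q f|) Q.set :=
    (hf.sub (integrableOn_const Q.volume_set_ne_top)).abs
  rw [mul_assoc, ← hKdef, ← ENNReal.ofReal_toReal hKtop]
  refine Cube.wnorm_le hp0 hB.le ENNReal.toReal_nonneg hosc_int ?_
  refine hdecay (fun t => volume.real (Q.level (fun x => |f x - Cube.ravg Q f|)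
    (ENNReal.ofReal t))) (a Q) _ (volume.real Q.set) haQ (by positivity)
    (fun t => measureReal_mono Cube.level_subset Q.volume_set_ne_top) hstart ?_
  exact fun t ht s hs => Cube.mul_volume_level_le_of_dpSup_le hp hKtop ha hf hosc hK ht hs
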